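/- Let K be a field and Λ a finite-dimensional associative unital K-algebra with l.Findim Λ < ∞. Then the class of left Λ-modules of finite projective dimension is closed under arbitrary direct products: any direct product of a family of left Λ-modules each of finite projective dimension again has finite projective dimension. -/

import Mathlib

universe u

/-- `HasProjDimLE Λ n M` means the left `Λ`-module `M` has projective dimension `≤ n`:
for `n = 0` it is projective, and for `n+1` there is a surjection from a projective module
whose kernel has projective dimension `≤ n`. -/
def HasProjDimLE (Λ : Type u) [Ring Λ] : ℕ → ModuleCat.{u} Λ → Prop
  | 0, M => Module.Projective Λ M
  | n + 1, M => ∃ (P : ModuleCat.{u} Λ) (g : P →ₗ[Λ] M),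
      Module.Projective Λ P ∧ Function.Surjective g ∧
        HasProjDimLE Λ n (ModuleCat.of Λ (LinearMap.ker g))

/-- A module has finite projective dimension. -/
def HasFinProjDim (Λ : Type u) [Ring Λ] (M : ModuleCat.{u} Λ) : Prop :=
  ∃ n, HasProjDimLE Λ n M

/-- `f : A → M` is a right `P^∞(Λ-mod)`-approximation of `M`. -/
def IsRightApprox (Λ : Type u) [Ring Λ] (M A : ModuleCat.{u} Λ) (f : A →ₗ[Λ] M) : Prop :=
  Module.Finite Λ A ∧ HasFinProjDim Λ A ∧
    ∀ (B : ModuleCat.{u} Λ), Module.Finite Λ B → HasFinProjDim Λ B →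
      ∀ g : B →ₗ[Λ] M, ∃ h : B →ₗ[Λ] A, f ∘ₗ h = g

/-- `f : M → A` is a left `P^∞(Λ-mod)`-approximation of `M`. -/
def IsLeftApprox (Λ : Type u) [Ring Λ] (M A : ModuleCat.{u} Λ) (f : M →ₗ[Λ] A) : Prop :=
  Module.Finite Λ A ∧ HasFinProjDim Λ A ∧
    ∀ (B : ModuleCat.{u} Λ), Module.Finite Λ B → HasFinProjDim Λ B →
      ∀ g : M →ₗ[Λ] B, ∃ h : A →ₗ[Λ] B, h ∘ₗ f = g

/-- `P^∞(Λ-mod)` is contravariantly finite in `Λ-mod`. -/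
def ContravariantlyFinite (Λ : Type u) [Ring Λ] : Prop :=
  ∀ M : ModuleCat.{u} Λ, Module.Finite Λ M →
    ∃ (A : ModuleCat.{u} Λ) (f : A →ₗ[Λ] M), IsRightApprox Λ M A f

/-- `P^∞(Λ-mod)` is covariantly finite in `Λ-mod`. -/
def CovariantlyFinite (Λ : Type u) [Ring Λ] : Prop :=
  ∀ M : ModuleCat.{u} Λ, Module.Finite Λ M →
    ∃ (A : ModuleCat.{u} Λ) (f : M →ₗ[Λ] A), IsLeftApprox Λ M A f

/-- The projective dimension of a module, as an element of `ℕ∞` (`⊤` if infinite). -/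
noncomputable def projDim (Λ : Type u) [Ring Λ] (M : ModuleCat.{u} Λ) : ℕ∞ :=
  sInf {d : ℕ∞ | ∃ n : ℕ, d = n ∧ HasProjDimLE Λ n M}

/-- The little finitistic dimension `l.findim Λ`. -/
noncomputable def finDimLittle (Λ : Type u) [Ring Λ] : ℕ∞ :=
  ⨆ (M : ModuleCat.{u} Λ) (_ : Module.Finite Λ M ∧ HasFinProjDim Λ M), projDim Λ M

/-- The big finitistic dimension `l.Findim Λ`. -/
noncomputable def finDimBig (Λ : Type u) [Ring Λ] : ℕ∞ :=
  ⨆ (M : ModuleCat.{u} Λ) (_ : HasFinProjDim Λ M), projDim Λ M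

/-- `M` is a direct limit of a directed system of finitely generated modules of finite
projective dimension. -/
def IsDirectLimitOfFGFinProjDim (Λ : Type u) [Ring Λ] (M : ModuleCat.{u} Λ) : Prop :=
  ∃ (ι : Type u) (_ : Preorder ι) (_ : DecidableEq ι), Nonempty ι ∧ IsDirected ι (· ≤ ·) ∧
    ∃ (G : ι → ModuleCat.{u} Λ) (f : ∀ i j : ι, i ≤ j → G i →ₗ[Λ] G j),
      DirectedSystem (fun i => G i) (fun i j h => f i j h) ∧
      (∀ i, Module.Finite Λ (G i) ∧ HasFinProjDim Λ (G i)) ∧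
      Nonempty ((Module.DirectLimit (fun i => G i) f) ≃ₗ[Λ] M)

/-- A finite-dimensional associative unital algebra over `K`, bundled. -/
structure FDAlg (K : Type u) [Field K] : Type (u + 1) where
  carrier : Type u
  [ringInst : Ring carrier]
  [algInst : Algebra K carrier]
  [fdInst : FiniteDimensional K carrier]

attribute [instance] FDAlg.ringInst FDAlg.algInst FDAlg.fdInst

open TensorProduct in
/-- Tensoring with a finite free module commutes with arbitrary products. -/
theorem pi_lTensor_proj_bijective (R S N : Type*) [CommRing R] [Ring S] [Algebra R S]
    [AddCommGroup N] [Module R N] [Module S N] [IsScalarTower R S N]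
    [Module.Free R N] [Module.Finite R N] {ι : Type*} (M : ι → Type*)
    [∀ i, AddCommGroup (M i)] [∀ i, Module R (M i)] :
    Function.Bijective (fun (x : N ⊗[R] (∀ i, M i)) i =>
      AlgebraTensorModule.lTensor S N (LinearMap.proj (R := R) (φ := M) i) x) := by
  classical
  let b := Module.Free.chooseBasis R N
  have key (x : N ⊗[R] (∀ i, M i)) (i : ι) (k) :
      equivFinsuppOfBasisLeft b
        (AlgebraTensorModule.lTensor S N (LinearMap.proj (R := R) (φ := M) i) x) k =
      equivFinsuppOfBasisLeft b x k i := by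
    induction x with
    | zero => simp
    | tmul n m => simp
    | add x y hx hy => simp only [map_add, Finsupp.add_apply, Pi.add_apply, hx, hy]
  constructor
  · intro x y hxy
    apply (equivFinsuppOfBasisLeft b).injective
    ext k i
    rw [← key, ← key]
    exact congrArg (fun z => equivFinsuppOfBasisLeft b z k) (congrFun hxy i)
  · intro y
    refine ⟨(equivFinsuppOfBasisLeft b).symm (Finsupp.equivFunOnFinite.symm
      fun k i => equivFinsuppOfBasisLeft b (y i) k), ?_⟩
    funext i
    apply (equivFinsuppOfBasisLeft b).injective
    ext k
    rw [key, LinearEquiv.apply_symm_apply]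
    rfl

open TensorProduct in
/-- Products of projective modules over a finite-dimensional algebra are projective. -/
theorem projective_pi_of_finiteDimensional (K Λ : Type*) [Field K] [Ring Λ] [Algebra K Λ]
    [FiniteDimensional K Λ] {ι : Type*} (P : ι → Type*) [∀ i, AddCommGroup (P i)]
    [∀ i, Module Λ (P i)] [h : ∀ i, Module.Projective Λ (P i)] :
    Module.Projective Λ (∀ i, P i) := by
  let _ (i : ι) : Module K (P i) := Module.compHom (P i) (algebraMap K Λ)
  have _ (i : ι) : IsScalarTower K Λ (P i) := IsScalarTower.of_compHom K Λ (P i)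
  let act (i : ι) : Λ ⊗[K] P i →ₗ[Λ] P i := AlgebraTensorModule.lift
    (LinearMap.toSpanSingleton Λ (P i →ₗ[K] P i) LinearMap.id)
  have act_surj (i : ι) : Function.Surjective (act i) := fun p => ⟨1 ⊗ₜ p, by simp [act]⟩
  choose s hs using fun i => Module.projective_lifting_property (act i) LinearMap.id (act_surj i)
  let e : (Λ ⊗[K] (∀ i, P i)) ≃ₗ[Λ] ∀ i, Λ ⊗[K] P i := LinearEquiv.ofBijective
    (LinearMap.pi fun i => AlgebraTensorModule.lTensor Λ Λ (LinearMap.proj (R := K) (φ := P) i))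
    (pi_lTensor_proj_bijective K Λ Λ P)
  have := Module.Projective.of_equiv e
  refine Module.Projective.of_split (LinearMap.piMap s) (LinearMap.piMap act) ?_
  ext x i
  exact LinearMap.congr_fun (hs i) (x i)

theorem HasProjDimLE.of_linearEquiv {Λ : Type u} [Ring Λ] {n : ℕ} {M N : ModuleCat.{u} Λ}
    (e : M ≃ₗ[Λ] N) (h : HasProjDimLE Λ n M) : HasProjDimLE Λ n N := by
  cases n with
  | zero =>
    have : Module.Projective Λ M := h
    exact Module.Projective.of_equiv e
  | succ n =>
    obtain ⟨P, g, hP, hg, hk⟩ := h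
    refine ⟨P, e.toLinearMap ∘ₗ g, hP, e.surjective.comp hg, ?_⟩
    rwa [LinearEquiv.ker_comp]

theorem HasProjDimLE.succ {Λ : Type u} [Ring Λ] {n : ℕ} {M : ModuleCat.{u} Λ}
    (h : HasProjDimLE Λ n M) : HasProjDimLE Λ (n + 1) M := by
  induction n generalizing M with
  | zero =>
    refine ⟨M, LinearMap.id, h, Function.surjective_id, ?_⟩
    rw [LinearMap.ker_id]
    change Module.Projective Λ (⊥ : Submodule Λ M)
    infer_instance
  | succ n ih =>
    obtain ⟨P, g, hP, hg, hk⟩ := h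
    exact ⟨P, g, hP, hg, ih hk⟩

theorem HasProjDimLE.mono {Λ : Type u} [Ring Λ] {m n : ℕ} (hmn : m ≤ n) {M : ModuleCat.{u} Λ}
    (h : HasProjDimLE Λ m M) : HasProjDimLE Λ n M :=
  Nat.le_induction h (fun _ _ ih => ih.succ) n hmn

/-- The kernel of a product of linear maps is the product of the kernels. -/
def kerPiMapEquiv {Λ : Type*} [Ring Λ] {ι : Type*} {P M : ι → Type*}
    [∀ i, AddCommGroup (P i)] [∀ i, Module Λ (P i)]
    [∀ i, AddCommGroup (M i)] [∀ i, Module Λ (M i)] (g : ∀ i, P i →ₗ[Λ] M i) :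
    (∀ i, LinearMap.ker (g i)) ≃ₗ[Λ] LinearMap.ker (LinearMap.piMap g) where
  toFun x := ⟨fun i => x i, by ext i; simp⟩
  invFun x i := ⟨x.1 i, congrFun x.2 i⟩
  map_add' _ _ := rfl
  map_smul' _ _ := rfl

theorem HasProjDimLE.pi (K : Type*) {Λ : Type u} [Field K] [Ring Λ] [Algebra K Λ]
    [FiniteDimensional K Λ] {n : ℕ} {ι : Type u} (G : ι → ModuleCat.{u} Λ)
    (h : ∀ i, HasProjDimLE Λ n (G i)) : HasProjDimLE Λ n (ModuleCat.of Λ (∀ i, G i)) := by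
  induction n generalizing G with
  | zero =>
    have (i : ι) : Module.Projective Λ (G i) := h i
    exact projective_pi_of_finiteDimensional K Λ fun i => G i
  | succ n ih =>
    choose P g hP hg hk using h
    exact ⟨ModuleCat.of Λ (∀ i, P i), LinearMap.piMap g,
      projective_pi_of_finiteDimensional K Λ fun i => P i, Function.Surjective.piMap hg,
      (ih _ hk).of_linearEquiv (kerPiMapEquiv g)⟩

theorem HasFinProjDim.exists_eq_projDim {Λ : Type u} [Ring Λ] {M : ModuleCat.{u} Λ}
    (h : HasFinProjDim Λ M) : ∃ n : ℕ, projDim Λ M = n ∧ HasProjDimLE Λ n M := by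
  obtain ⟨n, hn⟩ := h
  exact csInf_mem (s := {d : ℕ∞ | ∃ n : ℕ, d = n ∧ HasProjDimLE Λ n M}) ⟨n, n, rfl, hn⟩

theorem HasFinProjDim.projDim_le_finDimBig {Λ : Type u} [Ring Λ] {M : ModuleCat.{u} Λ}
    (h : HasFinProjDim Λ M) : projDim Λ M ≤ finDimBig Λ :=
  le_iSup₂ (f := fun (M : ModuleCat.{u} Λ) (_ : HasFinProjDim Λ M) => projDim Λ M) M h

/-- If `l.Findim Λ < ∞`, then the class of left `Λ`-modules of finite
projective dimension is closed under arbitrary direct products. -/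
theorem prod_hasFinProjDim_of_FinDim_finite
    (K : Type u) (Λ : Type u) [Field K] [Ring Λ] [Algebra K Λ] [FiniteDimensional K Λ]
    (hFin : finDimBig Λ ≠ ⊤)
    (ι : Type u) (G : ι → ModuleCat.{u} Λ)
    (h : ∀ i, HasFinProjDim Λ (G i)) :
    HasFinProjDim Λ (ModuleCat.of Λ (∀ i, G i)) := by
  obtain ⟨d, hd⟩ := ENat.ne_top_iff_exists.mp hFin
  refine ⟨d, HasProjDimLE.pi K G fun i => ?_⟩
  obtain ⟨n, hn, hGn⟩ := (h i).exists_eq_projDim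
  have hle := (h i).projDim_le_finDimBig
  rw [hn, ← hd] at hle
  exact hGn.mono (by exact_mod_cast hle)
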